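/- Let Γ_1, Γ_2, ... be a sequence of random positive semidefinite d×d matrices adapted to a filtration (F_t), satisfying E[Γ_{t+1} | F_t] ⪯ Γ_t − (Γ_t A_t A_t^T Γ_t)/(1 + A_t^T Γ_t A_t) a.s. for F_t-measurable unit vectors A_t, with A_t^T Γ_t A_t ≤ 1 a.s. Then E[Σ_{t=1}^T A_t^T Γ_t A_t] ≤ 2 log det(I + T Γ_1) when Γ_1 is deterministic. -/

import Mathlib

open Matrix MeasureTheory

open scoped MatrixOrder in
theorem Matrix.PosSemidef.exists_eq_transpose_mul_self {n : Type*} [Fintype n] [DecidableEq n]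
    {A : Matrix n n ℝ} (hA : A.PosSemidef) : ∃ Y : Matrix n n ℝ, A = Yᵀ * Y := by
  obtain ⟨Y, hY⟩ := CStarAlgebra.nonneg_iff_eq_star_mul_self.mp hA.nonneg
  exact ⟨Y, by rw [hY, star_eq_conjTranspose, conjTranspose_eq_transpose_of_trivial]⟩

theorem Matrix.PosSemidef.mul_mul_transpose_same {m n : Type*} [Fintype m] [Fintype n]
    {A : Matrix n n ℝ} (hA : A.PosSemidef) (B : Matrix m n ℝ) : (B * A * Bᵀ).PosSemidef := by
  simpa using hA.mul_mul_conjTranspose_same B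

theorem Matrix.PosSemidef.trace_mul_nonneg {n : Type*} [Fintype n] [DecidableEq n]
    {A B : Matrix n n ℝ} (hA : A.PosSemidef) (hB : B.PosSemidef) : 0 ≤ (A * B).trace := by
  obtain ⟨Y, rfl⟩ := hA.exists_eq_transpose_mul_self
  rw [Matrix.mul_assoc, trace_mul_comm]
  exact (hB.mul_mul_transpose_same Y).trace_nonneg

theorem Matrix.PosSemidef.log_det_le_trace_sub_card {n : Type*} [Fintype n] [DecidableEq n]
    {P : Matrix n n ℝ} (hP : P.PosSemidef) (hdet : P.det ≠ 0) :
    Real.log P.det ≤ P.trace - Fintype.card n := by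
  have hprod := hP.isHermitian.det_eq_prod_eigenvalues
  have htr := hP.isHermitian.trace_eq_sum_eigenvalues
  simp only [RCLike.ofReal_real_eq_id, id_eq] at hprod htr
  have hne : ∀ i ∈ Finset.univ, hP.isHermitian.eigenvalues i ≠ 0 :=
    Finset.prod_ne_zero_iff.mp (hprod ▸ hdet)
  rw [hprod, htr, Real.log_prod hne]
  calc ∑ i, Real.log (hP.isHermitian.eigenvalues i)
      ≤ ∑ i, (hP.isHermitian.eigenvalues i - 1) := Finset.sum_le_sum fun i hi =>
        Real.log_le_sub_one_of_pos ((hP.eigenvalues_nonneg i).lt_of_ne' (hne i hi))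
    _ = _ := by simp [Finset.sum_sub_distrib]

/-- The tangent-plane inequality expressing concavity of `log det`. -/
theorem Matrix.PosDef.log_det_le_tangent {n : Type*} [Fintype n] [DecidableEq n]
    {M N : Matrix n n ℝ} (hM : M.PosDef) (hN : N.PosDef) :
    Real.log N.det ≤ Real.log M.det + ((M⁻¹ * N).trace - Fintype.card n) := by
  obtain ⟨Y, hY⟩ := hM.inv.posSemidef.exists_eq_transpose_mul_self
  have hdet : (Y * N * Yᵀ).det = M.det⁻¹ * N.det := by
    rw [← Ring.inverse_eq_inv', ← det_nonsing_inv, hY, det_mul, det_mul, det_mul]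
    ring
  have hpos := mul_pos (inv_pos.mpr hM.det_pos) hN.det_pos
  have h := (hN.posSemidef.mul_mul_transpose_same Y).log_det_le_trace_sub_card
    (by rw [hdet]; exact hpos.ne')
  rw [hdet, Real.log_mul (inv_ne_zero hM.det_pos.ne') hN.det_pos.ne', Real.log_inv,
    trace_mul_comm, ← Matrix.mul_assoc, ← hY] at h
  linarith

theorem Matrix.PosDef.log_det_mono {n : Type*} [Fintype n] [DecidableEq n]
    {M N : Matrix n n ℝ} (hM : M.PosDef) (hN : N.PosDef) (h : (M - N).PosSemidef) :
    Real.log N.det ≤ Real.log M.det := by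
  have h1 := hM.log_det_le_tangent hN
  have h2 := hM.inv.posSemidef.trace_mul_nonneg h
  rw [Matrix.mul_sub, trace_sub, nonsing_inv_mul _ (M.isUnit_iff_isUnit_det.mp hM.isUnit),
    trace_one] at h2
  linarith

theorem Matrix.PosSemidef.posDef_one_add_smul {n : Type*} [Fintype n] [DecidableEq n]
    {A : Matrix n n ℝ} (hA : A.PosSemidef) {x : ℝ} (hx : 0 ≤ x) : (1 + x • A).PosDef :=
  PosDef.one.add_posSemidef (hA.smul hx)

/-- Entries of the resolvent `(1 + A)⁻¹` of a positive semidefinite matrix are at most one in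
absolute value. -/
theorem Matrix.PosSemidef.abs_inv_one_add_apply_le_one {n : Type*} [Fintype n] [DecidableEq n]
    {A : Matrix n n ℝ} (hA : A.PosSemidef) (i j : n) : |(1 + A)⁻¹ i j| ≤ 1 := by
  have hunit := (1 + A).isUnit_iff_isUnit_det.mp (PosDef.one.add_posSemidef hA).isUnit
  set v : n → ℝ := (1 + A)⁻¹ *ᵥ Pi.single j 1 with hv
  have hentry : ∀ k, (1 + A)⁻¹ k j = v k := fun k => by simp [hv]
  have hsolve : v + A *ᵥ v = Pi.single j 1 := by
    calc v + A *ᵥ v = (1 + A) *ᵥ v := by rw [add_mulVec, one_mulVec]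
      _ = _ := by rw [hv, mulVec_mulVec, mul_nonsing_inv _ hunit, one_mulVec]
  have hquad : v ⬝ᵥ v + v ⬝ᵥ (A *ᵥ v) = v j := by
    rw [← dotProduct_add, hsolve]; simp
  have hnonneg : 0 ≤ v ⬝ᵥ (A *ᵥ v) := by simpa using hA.dotProduct_mulVec_nonneg v
  have hsq : ∀ k, v k ^ 2 ≤ v j := fun k => by
    have : v k * v k ≤ v ⬝ᵥ v :=
      Finset.single_le_sum (f := fun k => v k * v k) (fun k _ => mul_self_nonneg _)
        (Finset.mem_univ k)
    nlinarith
  rw [hentry, ← sq_le_one_iff_abs_le_one]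
  nlinarith [hsq i, hsq j]

/-- The rank-one (Kalman) downdate of `G` in direction `a`. -/
noncomputable def rankOneDowndate {n : Type*} [Fintype n] (G : Matrix n n ℝ) (a : n → ℝ) :
    Matrix n n ℝ :=
  G - (1 + a ⬝ᵥ (G *ᵥ a))⁻¹ • (Gᵀ * vecMulVec a a * G)

section Downdate

variable {n : Type*} [Fintype n] [DecidableEq n] {G : Matrix n n ℝ}

omit [DecidableEq n] in
theorem vecMulVec_mul_mul_vecMulVec (G : Matrix n n ℝ) (a : n → ℝ) :
    vecMulVec a a * G * vecMulVec a a = (a ⬝ᵥ (G *ᵥ a)) • vecMulVec a a := by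
  rw [Matrix.mul_assoc, mul_vecMulVec, vecMulVec_mul_vecMulVec]
  ext i j
  simp [vecMulVec_apply]; ring

theorem Matrix.PosSemidef.rankOneDowndate (hG : G.PosSemidef) (a : n → ℝ) :
    (rankOneDowndate G a).PosSemidef := by
  have hq : 0 ≤ a ⬝ᵥ (G *ᵥ a) := by simpa using hG.dotProduct_mulVec_nonneg a
  have hE := vecMulVec_mul_mul_vecMulVec G a
  have hGt : Gᵀ = G := by simpa using hG.isHermitian.eq
  set q := a ⬝ᵥ (G *ᵥ a) with hqdef
  set E := vecMulVec a a with hEdef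
  have hEt : Eᵀ = E := by simp [hEdef, transpose_vecMulVec]
  have hEpsd : E.PosSemidef := by simpa using posSemidef_vecMulVec_self_star a
  set c := (1 + q)⁻¹ with hc
  have hcq : c * q = 1 - c := by rw [hc]; field_simp; ring
  have key : _root_.rankOneDowndate G a =
      (1 - c • (G * E)) * G * (1 - c • (G * E))ᵀ + c ^ 2 • (G * E * Gᵀ) := by
    have h3 : G * E * G * (E * G) = q • (G * E * G) := by
      calc G * E * G * (E * G) = G * (E * G * E) * G := by simp only [Matrix.mul_assoc]
        _ = _ := by rw [hE]; simp
    rw [_root_.rankOneDowndate, ← hqdef, ← hEdef, ← hc]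
    simp only [transpose_sub, transpose_one, transpose_smul, transpose_mul, hGt, hEt,
      Matrix.sub_mul, Matrix.mul_sub, Matrix.one_mul, Matrix.mul_one, Matrix.smul_mul,
      Matrix.mul_smul, ← Matrix.mul_assoc]
    simp only [← Matrix.mul_assoc] at h3
    rw [h3]
    match_scalars
    · ring
    · linear_combination (-c) * hcq
  rw [key]
  exact (hG.mul_mul_transpose_same _).add ((hEpsd.mul_mul_transpose_same _).smul (sq_nonneg c))

theorem one_add_mul_mul_rankOneDowndate (hG : G.PosSemidef) (a : n → ℝ) :
    (1 + G * vecMulVec a a) * rankOneDowndate G a = G := by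
  have hq : 0 ≤ a ⬝ᵥ (G *ᵥ a) := by simpa using hG.dotProduct_mulVec_nonneg a
  have hE := vecMulVec_mul_mul_vecMulVec G a
  have hGt : Gᵀ = G := by simpa using hG.isHermitian.eq
  rw [rankOneDowndate, hGt]
  set q := a ⬝ᵥ (G *ᵥ a)
  set E := vecMulVec a a
  have h3 : G * E * (G * E * G) = q • (G * E * G) := by
    calc G * E * (G * E * G) = G * (E * G * E) * G := by simp only [Matrix.mul_assoc]
      _ = _ := by rw [hE]; simp
  have hcq : (1 + q)⁻¹ * q = 1 - (1 + q)⁻¹ := by field_simp; ring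
  rw [Matrix.add_mul, Matrix.one_mul, Matrix.mul_sub, Matrix.mul_smul, h3]
  match_scalars
  · ring
  · linear_combination (-1 : ℝ) * hcq

theorem Matrix.PosSemidef.log_one_add_add_log_det_downdate_le (hG : G.PosSemidef) {a : n → ℝ}
    (ha : a ⬝ᵥ a = 1) {x : ℝ} (hx : 0 ≤ x) :
    Real.log (1 + a ⬝ᵥ (G *ᵥ a)) + Real.log (1 + x • _root_.rankOneDowndate G a).det ≤
      Real.log (1 + (x + 1) • G).det := by
  have hq : 0 ≤ a ⬝ᵥ (G *ᵥ a) := by simpa using hG.dotProduct_mulVec_nonneg a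
  have hdetE : (1 + G * vecMulVec a a).det = 1 + a ⬝ᵥ (G *ᵥ a) := by
    rw [mul_vecMulVec, vecMulVec_eq Unit, det_one_add_replicateCol_mul_replicateRow]
  have hfac := one_add_mul_mul_rankOneDowndate hG a
  have hpos := ((hG.rankOneDowndate a).posDef_one_add_smul hx).det_pos
  obtain ⟨Y, hY⟩ := hG.exists_eq_transpose_mul_self
  set E := vecMulVec a a with hE
  have hEt : Eᵀ = E := by simp [hE, transpose_vecMulVec]
  have hEE : E * E = E := by rw [hE, vecMulVec_mul_vecMulVec, ha, one_smul]
  have hEpsd : E.PosSemidef := by simpa using posSemidef_vecMulVec_self_star a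
  have hcompl : (1 - E).PosSemidef := by
    have := (PosSemidef.one (n := n) (R := ℝ)).mul_mul_transpose_same (1 - E)
    simpa [Matrix.mul_sub, Matrix.sub_mul, hEt, hEE] using this
  have hdet : (1 + G * E).det * (1 + x • _root_.rankOneDowndate G a).det =
      (1 + Y * (E + x • 1) * Yᵀ).det := by
    rw [← det_mul, Matrix.mul_add, Matrix.mul_one, Matrix.mul_smul, hfac, Matrix.mul_assoc,
      det_one_add_mul_comm Y, Matrix.mul_assoc, ← hY, det_one_add_mul_comm, Matrix.mul_add, Matrix.mul_smul, Matrix.mul_one, add_assoc]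
  have hdet' : (1 + (x + 1) • G).det = (1 + Y * ((x + 1) • 1) * Yᵀ).det := by
    rw [Matrix.mul_assoc, det_one_add_mul_comm, hY]
    simp
  rw [← hdetE, ← Real.log_mul (by rw [hdetE]; positivity) hpos.ne', hdet, hdet']
  have hK : (E + x • 1).PosSemidef := hEpsd.add (PosSemidef.one.smul hx)
  have hK' : ((x + 1) • (1 : Matrix n n ℝ)).PosSemidef := PosSemidef.one.smul (by positivity)
  refine (PosDef.one.add_posSemidef (hK'.mul_mul_transpose_same Y)).log_det_mono
    (PosDef.one.add_posSemidef (hK.mul_mul_transpose_same Y)) ?_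
  convert hcompl.mul_mul_transpose_same Y using 1
  rw [add_sub_add_left_eq_sub, ← Matrix.sub_mul, ← Matrix.mul_sub]
  congr 2
  module

end Downdate

section Measurability

variable {Ω n : Type*} {m : MeasurableSpace Ω} [Fintype n] [DecidableEq n]
  {M : Ω → Matrix n n ℝ}

theorem Matrix.measurable_det_of_entries (hM : ∀ i j, Measurable fun ω => M ω i j) :
    Measurable fun ω => (M ω).det := by
  simp only [det_apply']
  fun_prop

theorem Matrix.measurable_inv_of_entries (hM : ∀ i j, Measurable fun ω => M ω i j) (i j : n) :
    Measurable fun ω => (M ω)⁻¹ i j := by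
  simp only [inv_def, smul_apply, adjugate_apply, Ring.inverse_eq_inv', smul_eq_mul]
  refine (measurable_det_of_entries hM).inv.mul (measurable_det_of_entries fun k l => ?_)
  by_cases h : k = j
  · subst h; simp
  · simpa [updateRow_ne h] using hM k l

omit [Fintype n] in
theorem Matrix.measurable_one_add_smul_apply (hM : ∀ i j, Measurable fun ω => M ω i j) (x : ℝ)
    (i j : n) : Measurable fun ω => (1 + x • M ω) i j := by
  simpa using ((hM i j).const_mul x).const_add _

omit [DecidableEq n] in
theorem measurable_dotProduct_mulVec {a : Ω → n → ℝ} (hM : ∀ i j, Measurable fun ω => M ω i j)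
    (ha : ∀ i, Measurable fun ω => a ω i) : Measurable fun ω => a ω ⬝ᵥ (M ω *ᵥ a ω) := by
  simp only [dotProduct, mulVec]
  fun_prop

omit [DecidableEq n] in
theorem measurable_rankOneDowndate_apply {a : Ω → n → ℝ}
    (hM : ∀ i j, Measurable fun ω => M ω i j) (ha : ∀ i, Measurable fun ω => a ω i) (i j : n) :
    Measurable fun ω => rankOneDowndate (M ω) (a ω) i j := by
  have hq := measurable_dotProduct_mulVec hM ha
  simp only [rankOneDowndate, Matrix.sub_apply, Matrix.smul_apply, smul_eq_mul, mul_apply,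
    transpose_apply, vecMulVec_apply]
  fun_prop

end Measurability

section Expectation

variable {Ω n : Type*} {m m0 : MeasurableSpace Ω} {μ : Measure Ω} [IsProbabilityMeasure μ]
  [Fintype n] [DecidableEq n]

omit [IsProbabilityMeasure μ] in
theorem integrable_log_det_one_add_smul {G : Ω → Matrix n n ℝ}
    (hGm : ∀ i j, Measurable fun ω => G ω i j) (hGi : ∀ i j, Integrable (fun ω => G ω i j) μ)
    (hG : ∀ᵐ ω ∂μ, (G ω).PosSemidef) {x : ℝ} (hx : 0 ≤ x) :
    Integrable (fun ω => Real.log (1 + x • G ω).det) μ := by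
  have htr : Integrable (fun ω => x * (G ω).trace) μ :=
    (integrable_finsetSum _ fun i _ => hGi i i).const_mul x
  refine htr.mono' (measurable_det_of_entries
    (measurable_one_add_smul_apply hGm x)).log.aestronglyMeasurable ?_
  filter_upwards [hG] with ω hω
  have hpd := hω.posDef_one_add_smul hx
  have hlow := hpd.log_det_mono PosDef.one (by simpa using hω.smul hx)
  have hup := (PosDef.one (n := n) (R := ℝ)).log_det_le_tangent hpd
  simp only [det_one, Real.log_one, inv_one, Matrix.one_mul, trace_add, trace_one, trace_smul,
    smul_eq_mul] at hlow hup
  rw [Real.norm_eq_abs, abs_of_nonneg hlow]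
  linarith

omit [IsProbabilityMeasure μ] [DecidableEq n] in
theorem integrable_trace_mul {B N : Ω → Matrix n n ℝ}
    (hBm : ∀ i j, AEStronglyMeasurable (fun ω => B ω i j) μ) {c : ℝ}
    (hB : ∀ i j, ∀ᵐ ω ∂μ, |B ω i j| ≤ c) (hN : ∀ i j, Integrable (fun ω => N ω i j) μ) :
    Integrable (fun ω => (B ω * N ω).trace) μ := by
  simp only [trace, diag_apply, mul_apply]
  exact integrable_finsetSum _ fun i _ => integrable_finsetSum _ fun j _ =>
    (hN j i).bdd_mul (hBm i j) (hB i j)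

omit [DecidableEq n] in
theorem integral_trace_mul_condExp (hm : m ≤ m0) {B N : Ω → Matrix n n ℝ}
    (hBm : ∀ i j, Measurable[m] fun ω => B ω i j) {c : ℝ}
    (hB : ∀ i j, ∀ᵐ ω ∂μ, |B ω i j| ≤ c) (hN : ∀ i j, Integrable (fun ω => N ω i j) μ) :
    ∫ ω, (B ω * N ω).trace ∂μ =
      ∫ ω, (B ω * Matrix.of fun i j => (μ[fun a => N a i j | m]) ω).trace ∂μ := by
  have hBa : ∀ i j, AEStronglyMeasurable (fun ω => B ω i j) μ := fun i j =>
    ((hBm i j).mono hm le_rfl).aestronglyMeasurable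
  have hint : ∀ i j, Integrable (fun ω => B ω i j * N ω j i) μ := fun i j =>
    (hN j i).bdd_mul (hBa i j) (hB i j)
  have hint' : ∀ i j, Integrable (fun ω => B ω i j * (μ[fun a => N a j i | m]) ω) μ :=
    fun i j => integrable_condExp.bdd_mul (hBa i j) (hB i j)
  simp only [trace, diag_apply, mul_apply, of_apply]
  rw [integral_finsetSum _ fun i _ => integrable_finsetSum _ fun j _ => hint i j,
    integral_finsetSum _ fun i _ => integrable_finsetSum _ fun j _ => hint' i j]
  refine Finset.sum_congr rfl fun i _ => ?_
  rw [integral_finsetSum _ fun j _ => hint i j, integral_finsetSum _ fun j _ => hint' i j]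
  refine Finset.sum_congr rfl fun j _ => ?_
  rw [← integral_condExp hm]
  exact integral_congr_ae (condExp_mul_of_stronglyMeasurable_left
    (hBm i j).stronglyMeasurable (hint i j) (hN j i))

/-- One step of the elliptical potential argument. -/
theorem integral_log_one_add_add_integral_log_det_le (hm : m ≤ m0) {G N : Ω → Matrix n n ℝ}
    {a : Ω → n → ℝ} (hGm : ∀ i j, Measurable[m] fun ω => G ω i j)
    (hGi : ∀ i j, Integrable (fun ω => G ω i j) μ) (hG : ∀ᵐ ω ∂μ, (G ω).PosSemidef)
    (hNm : ∀ i j, Measurable fun ω => N ω i j)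
    (hNi : ∀ i j, Integrable (fun ω => N ω i j) μ) (hN : ∀ᵐ ω ∂μ, (N ω).PosSemidef)
    (ham : ∀ i, Measurable[m] fun ω => a ω i) (ha : ∀ᵐ ω ∂μ, a ω ⬝ᵥ a ω = 1)
    (hlog : Integrable (fun ω => Real.log (1 + a ω ⬝ᵥ (G ω *ᵥ a ω))) μ)
    (hdec : ∀ᵐ ω ∂μ, (rankOneDowndate (G ω) (a ω) -
      Matrix.of fun i j => (μ[fun a => N a i j | m]) ω).PosSemidef) {x : ℝ} (hx : 0 ≤ x) :
    ∫ ω, Real.log (1 + a ω ⬝ᵥ (G ω *ᵥ a ω)) ∂μ + ∫ ω, Real.log (1 + x • N ω).det ∂μ ≤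
      ∫ ω, Real.log (1 + (x + 1) • G ω).det ∂μ := by
  set M : Ω → Matrix n n ℝ := fun ω => rankOneDowndate (G ω) (a ω) with hM
  set C : Ω → Matrix n n ℝ := fun ω => Matrix.of fun i j => (μ[fun a => N a i j | m]) ω with hC
  set B : Ω → Matrix n n ℝ := fun ω => (1 + x • M ω)⁻¹ with hB
  have hGm0 : ∀ i j, Measurable fun ω => G ω i j := fun i j => (hGm i j).mono hm le_rfl
  have hBm : ∀ i j, Measurable[m] fun ω => B ω i j :=
    measurable_inv_of_entries
      (measurable_one_add_smul_apply (measurable_rankOneDowndate_apply hGm ham) x)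
  have hBa : ∀ i j, AEStronglyMeasurable (fun ω => B ω i j) μ := fun i j =>
    ((hBm i j).mono hm le_rfl).aestronglyMeasurable
  have hBbd : ∀ i j, ∀ᵐ ω ∂μ, |B ω i j| ≤ 1 := fun i j => by
    filter_upwards [hG] with ω hω
    exact ((hω.rankOneDowndate (a ω)).smul hx).abs_inv_one_add_apply_le_one i j
  have hBi : Integrable (fun ω => (B ω).trace) μ :=
    integrable_finsetSum _ fun i _ => Integrable.of_bound (hBa i i) 1 (hBbd i i)
  have hBNi := integrable_trace_mul hBa hBbd hNi
  have hBCi : Integrable (fun ω => (B ω * C ω).trace) μ :=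
    integrable_trace_mul hBa hBbd fun i j => integrable_condExp
  have hsplit : ∀ (ω : Ω) (K : Matrix n n ℝ),
      (B ω * (1 + x • K)).trace = (B ω).trace + x * (B ω * K).trace := fun ω K => by
    simp [Matrix.mul_add]
  have htrace : ∫ ω, (B ω).trace ∂μ + x * ∫ ω, (B ω * N ω).trace ∂μ ≤ Fintype.card n := by
    rw [integral_trace_mul_condExp hm hBm hBbd hNi, ← integral_const_mul,
      ← integral_add hBi (hBCi.const_mul x)]
    have hconst : ∫ _ : Ω, (Fintype.card n : ℝ) ∂μ = Fintype.card n := by simp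
    rw [← hconst]
    refine integral_mono_ae (hBi.add (hBCi.const_mul x)) (integrable_const _) ?_
    filter_upwards [hG, hdec] with ω hω hdω
    have hpd := (hω.rankOneDowndate (a ω)).posDef_one_add_smul hx
    have h1 := mul_nonneg hx (hpd.inv.posSemidef.trace_mul_nonneg hdω)
    have h2 : (B ω * (1 + x • M ω)).trace = Fintype.card n := by
      rw [hB, nonsing_inv_mul _ (isUnit_iff_isUnit_det _ |>.mp hpd.isUnit), trace_one]
    rw [Matrix.mul_sub, trace_sub] at h1
    rw [hsplit] at h2
    change (B ω).trace + x * (B ω * C ω).trace ≤ Fintype.card n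
    linarith
  have hBNtr : Integrable (fun ω => (B ω).trace + x * (B ω * N ω).trace) μ :=
    hBi.add (hBNi.const_mul x)
  have hrem : Integrable
      (fun ω => (B ω).trace + x * (B ω * N ω).trace - (Fintype.card n : ℝ)) μ :=
    hBNtr.sub (integrable_const _)
  have hNlog := integrable_log_det_one_add_smul hNm hNi hN hx
  have hGlog := integrable_log_det_one_add_smul hGm0 hGi hG (add_nonneg hx zero_le_one)
  have hmono : ∫ ω, (Real.log (1 + a ω ⬝ᵥ (G ω *ᵥ a ω)) + Real.log (1 + x • N ω).det) ∂μ ≤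
      ∫ ω, (Real.log (1 + (x + 1) • G ω).det +
        ((B ω).trace + x * (B ω * N ω).trace - Fintype.card n)) ∂μ := by
    refine integral_mono_ae (hlog.add hNlog)
      (hGlog.add hrem) ?_
    filter_upwards [hG, hN, ha] with ω hω hNω haω
    have h1 := hω.log_one_add_add_log_det_downdate_le haω hx
    have h2 := ((hω.rankOneDowndate (a ω)).posDef_one_add_smul hx).log_det_le_tangent
      (hNω.posDef_one_add_smul hx)
    have h3 := hsplit ω (N ω)
    simp only [hB, hM] at h3 ⊢
    linarith
  rw [integral_add hlog hNlog, integral_add hGlog hrem, integral_sub hBNtr (integrable_const _),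
    integral_add hBi (hBNi.const_mul x), integral_const_mul] at hmono
  simp only [integral_const, probReal_univ, one_smul] at hmono
  linarith

end Expectation

theorem le_two_mul_log_one_add {q : ℝ} (hq : 0 ≤ q) (hq1 : q ≤ 1) :
    q ≤ 2 * Real.log (1 + q) := by
  have h := Real.le_log_one_add_of_nonneg hq
  have h' : q / 2 ≤ 2 * q / (q + 2) := by
    rw [div_le_div_iff₀ (by positivity) (by positivity)]
    nlinarith
  linarith

/-- Abstract form of the general elliptical potential lemma (σ = 1): if the adapted
random PSD matrices `Γ_t` decrease in conditional expectation by the Kalman rank-one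
term, then the expected sum of the quadratic forms is at most `2 log det (I + T Γ_0)`. -/
theorem abstract_elliptical_potential {Ω : Type*} {m0 : MeasurableSpace Ω}
    (μ : Measure Ω) [IsProbabilityMeasure μ] {d T : ℕ}
    (F : ℕ → MeasurableSpace Ω) (hFmono : Monotone F) (hFle : ∀ t, F t ≤ m0)
    (Γ : ℕ → Ω → Matrix (Fin d) (Fin d) ℝ)
    (hΓadapted : ∀ t i j, Measurable[F t] fun ω => Γ t ω i j)
    (hΓpsd : ∀ t, ∀ᵐ ω ∂μ, (Γ t ω).PosSemidef)
    (hΓint : ∀ t i j, Integrable (fun ω => Γ t ω i j) μ)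
    (A : ℕ → Ω → Fin d → ℝ) (hAmeas : ∀ t i, Measurable[F t] fun ω => A t ω i)
    (hAunit : ∀ t, ∀ᵐ ω ∂μ, A t ω ⬝ᵥ A t ω = 1)
    (hbound : ∀ t, ∀ᵐ ω ∂μ, A t ω ⬝ᵥ (Γ t ω *ᵥ A t ω) ≤ 1)
    (hdec : ∀ t, ∀ᵐ ω ∂μ,
      ((Γ t ω - (1 + A t ω ⬝ᵥ (Γ t ω *ᵥ A t ω))⁻¹ •
          ((Γ t ω)ᵀ * Matrix.vecMulVec (A t ω) (A t ω) * Γ t ω)) -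
        Matrix.of fun i j => (μ[fun a => Γ (t + 1) a i j | F t]) ω).PosSemidef)
    (Γ0 : Matrix (Fin d) (Fin d) ℝ) (hΓ0 : ∀ᵐ ω ∂μ, Γ 0 ω = Γ0) :
    ∫ ω, ∑ t ∈ Finset.range T, A t ω ⬝ᵥ (Γ t ω *ᵥ A t ω) ∂μ ≤
      2 * Real.log ((1 + (T : ℝ) • Γ0).det) := by
  set q : ℕ → Ω → ℝ := fun t ω => A t ω ⬝ᵥ (Γ t ω *ᵥ A t ω) with hq
  have hΓmeas : ∀ t i j, Measurable fun ω => Γ t ω i j := fun t i j =>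
    (hΓadapted t i j).mono (hFle t) le_rfl
  have hqmeas : ∀ t, Measurable (q t) := fun t =>
    measurable_dotProduct_mulVec (hΓmeas t) fun i => (hAmeas t i).mono (hFle t) le_rfl
  have hq0 : ∀ t, ∀ᵐ ω ∂μ, 0 ≤ q t ω := fun t => by
    filter_upwards [hΓpsd t] with ω hω
    simpa using hω.dotProduct_mulVec_nonneg (A t ω)
  have hqint : ∀ t, Integrable (q t) μ := fun t => by
    refine Integrable.of_bound (hqmeas t).aestronglyMeasurable 1 ?_
    filter_upwards [hq0 t, hbound t] with ω h0 h1
    rwa [Real.norm_eq_abs, abs_of_nonneg h0]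
  have hlogint : ∀ t, Integrable (fun ω => Real.log (1 + q t ω)) μ := fun t => by
    refine (hqint t).mono' ((hqmeas t).const_add 1).log.aestronglyMeasurable ?_
    filter_upwards [hq0 t] with ω h0
    rw [Real.norm_eq_abs, abs_of_nonneg (Real.log_nonneg (by linarith))]
    linarith [Real.log_le_sub_one_of_pos (show 0 < 1 + q t ω by linarith)]
  have hpotential : ∀ (k : ℕ) (x : ℝ), 0 ≤ x →
      ∑ t ∈ Finset.range k, ∫ ω, Real.log (1 + q t ω) ∂μ +
        ∫ ω, Real.log (1 + x • Γ k ω).det ∂μ ≤ ∫ ω, Real.log (1 + (x + k) • Γ 0 ω).det ∂μ := by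
    intro k
    induction k with
    | zero => intro x _; simp
    | succ k ih =>
      intro x hx
      have hstep := integral_log_one_add_add_integral_log_det_le (hFle k) (hΓadapted k)
        (hΓint k) (hΓpsd k) (hΓmeas (k + 1)) (hΓint (k + 1)) (hΓpsd (k + 1)) (hAmeas k)
        (hAunit k) (hlogint k) (hdec k) hx
      have hprev := ih (x + 1) (by linarith)
      rw [Finset.sum_range_succ, Nat.cast_succ, add_comm (k : ℝ), ← add_assoc x]
      linarith
  have hfinal := hpotential T 0 le_rfl
  have hinit : ∫ ω, Real.log (1 + (0 + (T : ℝ)) • Γ 0 ω).det ∂μ =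
      Real.log (1 + (T : ℝ) • Γ0).det := by
    have hae : (fun ω => Real.log (1 + (0 + (T : ℝ)) • Γ 0 ω).det) =ᵐ[μ]
        fun _ => Real.log (1 + (T : ℝ) • Γ0).det := by
      filter_upwards [hΓ0] with ω hω
      rw [hω, zero_add]
    rw [integral_congr_ae hae]
    simp
  simp only [zero_smul, add_zero, det_one, Real.log_one, integral_zero, hinit] at hfinal
  rw [integral_finsetSum _ fun t _ => hqint t]
  calc ∑ t ∈ Finset.range T, ∫ ω, q t ω ∂μ
      ≤ ∑ t ∈ Finset.range T, 2 * ∫ ω, Real.log (1 + q t ω) ∂μ := by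
        refine Finset.sum_le_sum fun t _ => ?_
        rw [← integral_const_mul]
        refine integral_mono_ae (hqint t) ((hlogint t).const_mul 2) ?_
        filter_upwards [hq0 t, hbound t] with ω h0 h1
        exact le_two_mul_log_one_add h0 h1
    _ ≤ _ := by
        rw [← Finset.mul_sum]
        linarith
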